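/- Let n₁, n₂, n₃, n₄ be natural numbers, let Z be a real symmetric positive definite n₁×n₁ matrix, X a real symmetric n₂×n₂ matrix, Y a real symmetric negative definite n₄×n₄ matrix, V a real n₁×n₂ matrix and W a real n₂×n₄ matrix. Let M be the real symmetric square matrix of size n₁+n₂+n₃+n₄ whose block rows are [Z, V, 0, 0], [Vᵗ, X, 0, W], [0, 0, 0, 0], [0, Wᵗ, 0, Y]. Then the signature of M is (n₄+m⁻, n₃+m⁰, n₁+m⁺), where (m⁻, m⁰, m⁺) is the signature of the real symmetric n₂×n₂ matrix R = X − VᵗZ⁻¹V − WY⁻¹Wᵗ. -/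

import Mathlib

open Module Matrix

/-- The signature `(s⁻, s⁰, s⁺)` of a real square matrix: number of negative eigenvalues
(with multiplicity), dimension of the kernel, number of positive eigenvalues
(with multiplicity). -/
noncomputable def matSig {m : Type*} [Fintype m] [DecidableEq m]
    (A : Matrix m m ℝ) : ℕ × ℕ × ℕ :=
  (finrank ℝ ↥(⨆ μ : {x : ℝ // x < 0}, Module.End.eigenspace (Matrix.toLin' A) (μ : ℝ)),
   finrank ℝ ↥(LinearMap.ker (Matrix.toLin' A)),
   finrank ℝ ↥(⨆ μ : {x : ℝ // 0 < x}, Module.End.eigenspace (Matrix.toLin' A) (μ : ℝ)))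

lemma inertia_eqv {m : Type*} [Fintype m] [DecidableEq m] (w w' : m → ℝ) (T : Matrix m m ℝ)
    (hT : IsUnit T) (h : Tᵀ * diagonal w' * T = diagonal w) :
    QuadraticMap.Equivalent (QuadraticMap.weightedSumSquares ℝ w)
      (QuadraticMap.weightedSumSquares ℝ w') := by
  have hdet : IsUnit T.det := (Matrix.isUnit_iff_isUnit_det T).1 hT
  have key : ∀ (v : m → ℝ) (x : m → ℝ),
      QuadraticMap.weightedSumSquares ℝ v x = x ⬝ᵥ (diagonal v *ᵥ x) := by
    intro v x
    simp only [QuadraticMap.weightedSumSquares_apply, dotProduct, mulVec_diagonal, smul_eq_mul]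
    exact Finset.sum_congr rfl fun i _ => by ring
  refine ⟨⟨LinearEquiv.ofLinearMap (toLin' T) (toLin' T⁻¹) ?_ ?_, ?_⟩⟩
  · rw [← toLin'_mul, Matrix.mul_nonsing_inv _ hdet, toLin'_one]
  · rw [← toLin'_mul, Matrix.nonsing_inv_mul _ hdet, toLin'_one]
  · intro x
    change QuadraticMap.weightedSumSquares ℝ w' (T *ᵥ x) = _
    rw [key, key, ← h, ← mulVec_mulVec, ← mulVec_mulVec, dotProduct_mulVec x, vecMul_transpose]

lemma ncard_trich {m : Type*} [Fintype m] (w : m → ℝ) :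
    {i | w i < 0}.ncard + {i | w i = 0}.ncard + {i | 0 < w i}.ncard = Fintype.card m := by
  rw [← Set.ncard_union_eq, ← Set.ncard_union_eq, ← Nat.card_eq_fintype_card, ← Set.ncard_univ]
  · congr 1
    ext i
    simp only [Set.mem_union, Set.mem_ofPred_eq, Set.mem_univ, iff_true]
    rcases lt_trichotomy (w i) 0 with h | h | h <;> tauto
  · rw [Set.disjoint_left]
    rintro i (h | h) h' <;> simp only [Set.mem_ofPred_eq] at h h' <;> linarith
  · rw [Set.disjoint_left]
    intro i h h'; simp only [Set.mem_ofPred_eq] at h h'; linarith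

lemma spectral_sub {m : Type*} [Fintype m] [DecidableEq m] (A : Matrix m m ℝ)
    (b : m → m → ℝ) (hb : LinearIndependent ℝ b) (l : m → ℝ) (hl : ∀ i, A *ᵥ b i = l i • b i)
    (p : ℝ → Prop) (S : Submodule ℝ (m → ℝ))
    (hS : ∀ x, p x → Module.End.eigenspace (toLin' A) x ≤ S) :
    {i | p (l i)}.ncard ≤ finrank ℝ S := by
  classical
  have h1 : LinearIndependent ℝ (fun i : {i | p (l i)} => b i) :=
    hb.comp _ Subtype.val_injective
  have h2 := finrank_span_eq_card h1
  rw [← Nat.card_coe_set_eq, Nat.card_eq_fintype_card, ← h2]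
  apply Submodule.finrank_mono
  rw [Submodule.span_le]
  rintro _ ⟨i, rfl⟩
  apply hS _ i.2
  rw [Module.End.mem_eigenspace_iff]
  exact hl i

lemma spectral_sum {m : Type*} [Fintype m] [DecidableEq m] (A : Matrix m m ℝ) :
    (matSig A).1 + (matSig A).2.1 + (matSig A).2.2 ≤ Fintype.card m := by
  have hi := Module.End.eigenspaces_iSupIndep (toLin' A)
  have d1 : Disjoint (⨆ μ : {x : ℝ // x < 0}, Module.End.eigenspace (toLin' A) (μ : ℝ))
      (LinearMap.ker (toLin' A)) := by
    have := hi.disjoint_biSup (x := (0:ℝ)) (y := {x | x < 0}) (by simp)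
    rw [Module.End.eigenspace_zero] at this
    rw [iSup_subtype]
    exact this.symm
  have d2 : Disjoint ((⨆ μ : {x : ℝ // x < 0}, Module.End.eigenspace (toLin' A) (μ : ℝ)) ⊔
      (LinearMap.ker (toLin' A)))
      (⨆ μ : {x : ℝ // 0 < x}, Module.End.eigenspace (toLin' A) (μ : ℝ)) := by
    have := hi.disjoint_biSup_biSup (s := {x | x ≤ 0}) (t := {x | 0 < x}) (by
      rw [Set.disjoint_left]; intro x h h'; simp only [Set.mem_ofPred_eq] at h h'; linarith)
    rw [iSup_subtype, iSup_subtype]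
    refine this.mono_left (sup_le ?_ ?_)
    · exact biSup_mono fun x hx => le_of_lt hx
    · rw [← Module.End.eigenspace_zero]
      exact le_biSup (fun x => Module.End.eigenspace (toLin' A) x) (le_refl (0:ℝ))
  have e2 := Submodule.finrank_sup_add_finrank_inf_eq (⨆ μ : {x : ℝ // x < 0}, Module.End.eigenspace (toLin' A) (μ : ℝ)) (LinearMap.ker (toLin' A))
  rw [d1.eq_bot, finrank_bot] at e2
  have e3 := Submodule.finrank_add_finrank_le_of_disjoint d2
  rw [finrank_fintype_fun_eq_card] at e3
  simp only [matSig]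
  omega

lemma matSig_of_congr {m : Type*} [Fintype m] [DecidableEq m] (A Q : Matrix m m ℝ) (w : m → ℝ)
    (hQ : IsUnit Q) (h : A = Qᵀ * diagonal w * Q) :
    matSig A = ({i | w i < 0}.ncard, {i | w i = 0}.ncard, {i | 0 < w i}.ncard) := by
  have hA : A.IsHermitian := by
    rw [Matrix.IsHermitian, conjTranspose_eq_transpose_of_trivial, h]
    simp [Matrix.mul_assoc]
  set l := hA.eigenvalues with hl
  have hsp : diagonal l = (Q * (hA.eigenvectorUnitary : Matrix m m ℝ))ᵀ * diagonal w *
      (Q * (hA.eigenvectorUnitary : Matrix m m ℝ)) := by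
    have := hA.conjStarAlgAut_star_eigenvectorUnitary
    rw [Unitary.conjStarAlgAut_star_apply, star_eq_conjTranspose,
      conjTranspose_eq_transpose_of_trivial] at this
    rw [transpose_mul]
    have e : (diagonal l : Matrix m m ℝ) = diagonal (RCLike.ofReal ∘ hA.eigenvalues) := rfl
    rw [e, ← this]
    have h2 : ∀ B : Matrix m m ℝ, Bᵀ * A * B = Bᵀ * Qᵀ * diagonal w * (Q * B) := by
      intro B
      rw [h]
      simp only [Matrix.mul_assoc]
    exact h2 _
  have hU : IsUnit (hA.eigenvectorUnitary : Matrix m m ℝ) :=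
    (Unitary.toUnits hA.eigenvectorUnitary).isUnit
  have heq := inertia_eqv l w _ (hQ.mul hU) hsp.symm
  have p1 := heq.sigPos_eq
  have p2 := heq.sigNeg_eq
  rw [QuadraticForm.sigPos_weightedSumSquares, QuadraticForm.sigPos_weightedSumSquares] at p1
  rw [QuadraticForm.sigNeg_weightedSumSquares, QuadraticForm.sigNeg_weightedSumSquares] at p2
  have t1 := ncard_trich l
  have t2 := ncard_trich w
  have hb : LinearIndependent ℝ (fun i => (hA.eigenvectorBasis i).ofLp) := by
    have h3 := hA.eigenvectorBasis.toBasis.linearIndependent.map'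
      (WithLp.linearEquiv 2 ℝ (m → ℝ)).toLinearMap (LinearEquiv.ker _)
    have h4 : (fun i => (hA.eigenvectorBasis i).ofLp) =
        ⇑(WithLp.linearEquiv 2 ℝ (m → ℝ)).toLinearMap ∘ ⇑hA.eigenvectorBasis.toBasis := by
      ext i
      simp
    rw [h4]
    exact h3
  have hsub := spectral_sub A _ hb l (fun i => hA.mulVec_eigenvectorBasis i)
  have s1 : _ ≤ (matSig A).1 := hsub (fun x => x < 0) _
    fun x hx => le_iSup (fun μ : {x : ℝ // x < 0} => Module.End.eigenspace (toLin' A) (μ : ℝ)) ⟨x, hx⟩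
  have s2 : _ ≤ (matSig A).2.1 := hsub (fun x => x = 0) _
    fun x hx => by rw [hx, Module.End.eigenspace_zero]
  have s3 : _ ≤ (matSig A).2.2 := hsub (fun x => 0 < x) _
    fun x hx => le_iSup (fun μ : {x : ℝ // 0 < x} => Module.End.eigenspace (toLin' A) (μ : ℝ)) ⟨x, hx⟩
  have s4 := spectral_sum A
  refine Prod.ext ?_ (Prod.ext ?_ ?_) <;> dsimp only <;> omega

lemma exists_diag {m : Type*} [Fintype m] [DecidableEq m] (A : Matrix m m ℝ)
    (hA : A.IsHermitian) :
    ∃ Q : Matrix m m ℝ, Qᵀ * Q = 1 ∧ A = Qᵀ * diagonal hA.eigenvalues * Q := by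
  refine ⟨(hA.eigenvectorUnitary : Matrix m m ℝ)ᵀ, ?_, ?_⟩
  · have := Unitary.coe_mul_star_self hA.eigenvectorUnitary
    rw [Unitary.coe_star, star_eq_conjTranspose, conjTranspose_eq_transpose_of_trivial] at this
    simpa using this
  · have := hA.spectral_theorem
    rw [Unitary.conjStarAlgAut_apply, star_eq_conjTranspose,
      conjTranspose_eq_transpose_of_trivial] at this
    rw [transpose_transpose]
    exact this

lemma ncard_sum_elim {α β : Type*} [Fintype α] [Fintype β] (f : α → ℝ) (g : β → ℝ)
    (p : ℝ → Prop) : {i | p (Sum.elim f g i)}.ncard = {i | p (f i)}.ncard + {i | p (g i)}.ncard := by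
  have : {i | p (Sum.elim f g i)} = Sum.inl '' {i | p (f i)} ∪ Sum.inr '' {i | p (g i)} := by
    ext (i | i) <;> simp
  rw [this, Set.ncard_union_eq, Set.ncard_image_of_injective _ Sum.inl_injective,
    Set.ncard_image_of_injective _ Sum.inr_injective]
  rw [Set.disjoint_left]
  rintro _ ⟨i, _, rfl⟩ ⟨j, _, h⟩
  cases h

theorem block_matrix_signature (n₁ n₂ n₃ n₄ : ℕ)
    (Z : Matrix (Fin n₁) (Fin n₁) ℝ) (X : Matrix (Fin n₂) (Fin n₂) ℝ)
    (Y : Matrix (Fin n₄) (Fin n₄) ℝ) (V : Matrix (Fin n₁) (Fin n₂) ℝ)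
    (W : Matrix (Fin n₂) (Fin n₄) ℝ)
    (hZ : Z.PosDef) (hX : X.IsSymm) (hY : (-Y).PosDef) :
    matSig
      (Matrix.fromBlocks
        (Matrix.fromBlocks Z V Vᵀ X) (Matrix.fromBlocks 0 0 0 W)
        (Matrix.fromBlocks (0 : Matrix (Fin n₃) (Fin n₁) ℝ) 0 0 Wᵀ)
        (Matrix.fromBlocks (0 : Matrix (Fin n₃) (Fin n₃) ℝ) 0 0 Y)) =
      (n₄ + (matSig (X - Vᵀ * Z⁻¹ * V - W * Y⁻¹ * Wᵀ)).1,
       n₃ + (matSig (X - Vᵀ * Z⁻¹ * V - W * Y⁻¹ * Wᵀ)).2.1,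
       n₁ + (matSig (X - Vᵀ * Z⁻¹ * V - W * Y⁻¹ * Wᵀ)).2.2) := by
  have hZt : Zᵀ = Z := by
    have := hZ.isHermitian
    rwa [Matrix.IsHermitian, conjTranspose_eq_transpose_of_trivial] at this
  have hYt : Yᵀ = Y := by
    have := hY.isHermitian
    rw [Matrix.IsHermitian, conjTranspose_eq_transpose_of_trivial, transpose_neg] at this
    exact neg_injective this
  have hZd : IsUnit Z.det := (Matrix.isUnit_iff_isUnit_det Z).1 hZ.isUnit
  have hYd : IsUnit Y.det := by
    rw [← Matrix.isUnit_iff_isUnit_det]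
    simpa using hY.isUnit.neg
  set R := X - Vᵀ * Z⁻¹ * V - W * Y⁻¹ * Wᵀ with hRdef
  have hR : R.IsHermitian := by
    rw [Matrix.IsHermitian, conjTranspose_eq_transpose_of_trivial, hRdef]
    simp only [transpose_sub, transpose_mul, transpose_transpose, transpose_nonsing_inv, hZt, hYt,
      hX.eq, Matrix.mul_assoc]
  obtain ⟨P, hP1, hP⟩ := exists_diag Z hZ.isHermitian
  obtain ⟨S, hS1, hS⟩ := exists_diag R hR
  obtain ⟨T, hT1, hT⟩ := exists_diag (-Y) hY.isHermitian
  have hT' : Y = Tᵀ * diagonal (-hY.isHermitian.eigenvalues) * T := by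
    have : diagonal (-hY.isHermitian.eigenvalues) = - diagonal hY.isHermitian.eigenvalues := by
      rw [diagonal_neg]; rfl
    rw [this, Matrix.mul_neg, Matrix.neg_mul, ← hT, neg_neg]
  have isu : ∀ {n : ℕ} {B : Matrix (Fin n) (Fin n) ℝ}, Bᵀ * B = 1 → IsUnit B := fun h =>
    IsUnit.of_mul_eq_one_right _ h
  rw [matSig_of_congr R S _ (isu hS1) hS]
  set z := hZ.isHermitian.eigenvalues
  set y := hY.isHermitian.eigenvalues
  set r := hR.eigenvalues
  let L : Matrix ((Fin n₁ ⊕ Fin n₂) ⊕ (Fin n₃ ⊕ Fin n₄)) ((Fin n₁ ⊕ Fin n₂) ⊕ (Fin n₃ ⊕ Fin n₄)) ℝ :=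
    fromBlocks (fromBlocks 1 (Z⁻¹ * V) 0 1) 0 (fromBlocks 0 0 0 (Y⁻¹ * Wᵀ)) 1
  let L' : Matrix ((Fin n₁ ⊕ Fin n₂) ⊕ (Fin n₃ ⊕ Fin n₄)) ((Fin n₁ ⊕ Fin n₂) ⊕ (Fin n₃ ⊕ Fin n₄)) ℝ :=
    fromBlocks (fromBlocks 1 (-(Z⁻¹ * V)) 0 1) 0 (fromBlocks 0 0 0 (-(Y⁻¹ * Wᵀ))) 1
  have hL : L' * L = 1 := by
    simp only [L, L', fromBlocks_multiply, ← fromBlocks_one]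
    simp [fromBlocks_multiply, fromBlocks_add]
  let U : Matrix ((Fin n₁ ⊕ Fin n₂) ⊕ (Fin n₃ ⊕ Fin n₄)) ((Fin n₁ ⊕ Fin n₂) ⊕ (Fin n₃ ⊕ Fin n₄)) ℝ :=
    fromBlocks (fromBlocks P 0 0 S) 0 0 (fromBlocks 1 0 0 T)
  have hU : Uᵀ * U = 1 := by
    simp [U, fromBlocks_multiply, fromBlocks_transpose, hP1, hS1, hT1]
  have hD : Uᵀ * diagonal (Sum.elim (Sum.elim z r) (Sum.elim 0 (-y))) * U =
      fromBlocks (fromBlocks Z 0 0 R) 0 0 (fromBlocks 0 0 0 Y) := by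
    rw [← fromBlocks_diagonal, ← fromBlocks_diagonal, ← fromBlocks_diagonal]
    simp [U, fromBlocks_multiply, fromBlocks_transpose, ← hP, ← hS, ← hT',
      -fromBlocks_diagonal]
  rw [matSig_of_congr _ (U * L) (Sum.elim (Sum.elim z r) (Sum.elim 0 (-y)))
    ((IsUnit.of_mul_eq_one_right _ hU).mul (IsUnit.of_mul_eq_one_right _ hL)) ?_]
  · have hz : ∀ i, 0 < z i := fun i => hZ.eigenvalues_pos i
    have hy : ∀ i, 0 < y i := fun i => hY.eigenvalues_pos i
    have hz1 : ∀ i, ¬ z i < 0 := fun i => (hz i).le.not_gt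
    have hy1 : ∀ i, ¬ y i < 0 := fun i => (hy i).le.not_gt
    have hz2 : ∀ i, z i ≠ 0 := fun i => (hz i).ne'
    have hy2 : ∀ i, y i ≠ 0 := fun i => (hy i).ne'
    refine Prod.ext ?_ (Prod.ext ?_ ?_) <;> dsimp only
    · rw [ncard_sum_elim _ _ (fun x => x < 0), ncard_sum_elim _ _ (fun x => x < 0),
        ncard_sum_elim _ _ (fun x => x < 0)]
      simp [hz1, hy, Set.ncard_univ]
      omega
    · rw [ncard_sum_elim _ _ (fun x => x = 0), ncard_sum_elim _ _ (fun x => x = 0),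
        ncard_sum_elim _ _ (fun x => x = 0)]
      simp [hz2, hy2, Set.ncard_univ]
      omega
    · rw [ncard_sum_elim _ _ (fun x => 0 < x), ncard_sum_elim _ _ (fun x => 0 < x),
        ncard_sum_elim _ _ (fun x => 0 < x)]
      simp [hz, hy1, Set.ncard_univ]
  · have e : (U * L)ᵀ * diagonal (Sum.elim (Sum.elim z r) (Sum.elim 0 (-y))) * (U * L) =
        Lᵀ * (Uᵀ * diagonal (Sum.elim (Sum.elim z r) (Sum.elim 0 (-y))) * U) * L := by
      simp only [transpose_mul, Matrix.mul_assoc]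
    rw [e, hD]
    have a1 : Z * (Z⁻¹ * V) = V := by rw [← Matrix.mul_assoc, mul_nonsing_inv _ hZd, Matrix.one_mul]
    have a2 : Y * (Y⁻¹ * Wᵀ) = Wᵀ := by
      rw [← Matrix.mul_assoc, mul_nonsing_inv _ hYd, Matrix.one_mul]
    have a3 : W * (Y⁻¹ * Y) = W := by rw [nonsing_inv_mul _ hYd, Matrix.mul_one]
    have a4 : Vᵀ * (Z⁻¹ * Z) = Vᵀ := by rw [nonsing_inv_mul _ hZd, Matrix.mul_one]
    simp [L, fromBlocks_multiply, fromBlocks_transpose, fromBlocks_add, transpose_nonsing_inv,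
      hZt, hYt, Matrix.mul_assoc, a1, a2, a3, a4, hRdef]
    abel
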